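/- Let φ ∈ H and let φ_i ∈ H_i satisfy ‖φ_i − φ‖_H → 0 as i → ∞. Then Σ_{k=0}^{N_i−1} ln det(I − ½ δ_{k,i} ∇_x f(t_{k+1,i}, φ_i(t_{k+1,i}))) converges, as i → ∞, to −½ ∫_0^T div_x f(t, φ(t)) dt. -/

import Mathlib

open MeasureTheory Set Filter

noncomputable section

/-- `φ` belongs to the Cameron–Martin space `H` on `[0,T]`, with a.e. derivative `φ'`:
`φ` is absolutely continuous with (integrable) derivative `φ'` which is square integrable. -/
def IsCM {n : ℕ} (T : ℝ) (φ φ' : ℝ → EuclideanSpace ℝ (Fin n)) : Prop :=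
  IntervalIntegrable φ' volume 0 T ∧
  (∀ t ∈ Icc (0 : ℝ) T, φ t = φ 0 + ∫ s in (0 : ℝ)..t, φ' s) ∧
  IntervalIntegrable (fun s => ‖φ' s‖ ^ 2) volume 0 T

/-- Square of the Cameron–Martin norm `‖φ‖_H² = ‖φ(0)‖² + ∫₀ᵀ ‖φ̇(t)‖² dt`. -/
def cmNormSq {n : ℕ} (T : ℝ) (φ φ' : ℝ → EuclideanSpace ℝ (Fin n)) : ℝ :=
  ‖φ 0‖ ^ 2 + ∫ s in (0 : ℝ)..T, ‖φ' s‖ ^ 2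

/-- Mesh `δ̄ᵢ` of the `i`-th partition: the largest increment. -/
def mesh (tt : ℕ → ℕ → ℝ) (N : ℕ → ℕ) (i : ℕ) : ℝ :=
  ⨆ k : Fin (N i), (tt i (k + 1) - tt i k)

/-- `ψ` is piecewise linear (affine on each cell) w.r.t. the partition points
`tt 0 < … < tt N`. -/
def IsPL {n : ℕ} (tt : ℕ → ℝ) (N : ℕ) (ψ : ℝ → EuclideanSpace ℝ (Fin n)) : Prop :=
  ∀ k < N, ∀ s ∈ Icc (tt k) (tt (k + 1)),
    ψ s = ψ (tt k) + ((s - tt k) / (tt (k + 1) - tt k)) • (ψ (tt (k + 1)) - ψ (tt k))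

/-- `ψ'` is the (piecewise constant) slope derivative of the piecewise linear `ψ`. -/
def IsPLDeriv {n : ℕ} (tt : ℕ → ℝ) (N : ℕ) (ψ ψ' : ℝ → EuclideanSpace ℝ (Fin n)) : Prop :=
  ∀ k < N, ∀ s ∈ Ico (tt k) (tt (k + 1)),
    ψ' s = (tt (k + 1) - tt k)⁻¹ • (ψ (tt (k + 1)) - ψ (tt k))

/-- A nested sequence of partitions `Pᵢ = {0 = tᵢ₀ < … < tᵢ_{Nᵢ} = T}` of `[0, T]`
with mesh tending to zero. -/
structure NestedPartitions (T : ℝ) (tt : ℕ → ℕ → ℝ) (N : ℕ → ℕ) : Prop where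
  npos : ∀ i, 0 < N i
  zero : ∀ i, tt i 0 = 0
  last : ∀ i, tt i (N i) = T
  mono : ∀ i, ∀ k < N i, tt i k < tt i (k + 1)
  nested : ∀ i, ∀ k ≤ N i, ∃ l ≤ N (i + 1), tt (i + 1) l = tt i k
  meshZero : Tendsto (mesh tt N) atTop (nhds 0)

/-- The trace as a continuous linear functional on the continuous endomorphisms of a
finite-dimensional space. -/
def traceCLM (E : Type*) [NormedAddCommGroup E] [NormedSpace ℝ E] [FiniteDimensional ℝ E] :
    (E →L[ℝ] E) →L[ℝ] ℝ :=
  LinearMap.toContinuousLinearMap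
    (LinearMap.trace ℝ E ∘ₗ (ContinuousLinearMap.coeLM ℝ : (E →L[ℝ] E) →ₗ[ℝ] (E →ₗ[ℝ] E)))

@[simp]
theorem traceCLM_apply {E : Type*} [NormedAddCommGroup E] [NormedSpace ℝ E]
    [FiniteDimensional ℝ E] (A : E →L[ℝ] E) :
    traceCLM E A = LinearMap.trace ℝ E A.toLinearMap := rfl

/-- Along a line through the identity, the determinant has derivative the trace. -/
theorem hasDerivAt_det_one_add_smul {E : Type*} [NormedAddCommGroup E] [NormedSpace ℝ E]
    [FiniteDimensional ℝ E] (A : E →ₗ[ℝ] E) :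
    HasDerivAt (fun r : ℝ => LinearMap.det (LinearMap.id + r • A)) (LinearMap.trace ℝ E A) 0 := by
  classical
  let b := Module.finBasis ℝ E
  let M := LinearMap.toMatrix b b A
  have hdet : ∀ r : ℝ, LinearMap.det (LinearMap.id + r • A) = Matrix.det (1 + r • M) := fun r => by
    rw [← LinearMap.det_toMatrix b]
    rw [map_add, map_smul, LinearMap.toMatrix_id]
  rw [funext hdet, funext fun r => Matrix.det_one_add_smul r M]
  rw [LinearMap.trace_eq_matrix_trace ℝ b A]
  set p := (Matrix.det (1 + (Polynomial.X : Polynomial ℝ) • M.map Polynomial.C)).divX.divX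
  have h1 : HasDerivAt (fun r : ℝ => M.trace * r) M.trace 0 := by
    simpa using (hasDerivAt_id (0 : ℝ)).const_mul M.trace
  have h2 : HasDerivAt (fun r : ℝ => Polynomial.eval r p * r ^ 2) 0 0 := by
    simpa using (p.hasDerivAt 0).fun_mul (hasDerivAt_pow 2 (0 : ℝ))
  exact ((h1.const_add 1).fun_add h2).congr_deriv (add_zero _)

/-- The derivative of the determinant at the identity is the trace. -/
theorem hasFDerivAt_det_id_add {E : Type*} [NormedAddCommGroup E] [NormedSpace ℝ E]
    [FiniteDimensional ℝ E] :
    HasFDerivAt (fun A : E →L[ℝ] E => LinearMap.det (LinearMap.id + A.toLinearMap))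
      (traceCLM E) 0 := by
  classical
  let b := Module.finBasis ℝ E
  have hentry : ∀ i j, Differentiable ℝ
      (fun A : E →L[ℝ] E => LinearMap.toMatrix b b (LinearMap.id + A.toLinearMap) i j) := by
    intro i j
    let L : (E →L[ℝ] E) →ₗ[ℝ] ℝ :=
      (b.coord i ∘ₗ LinearMap.applyₗ (b j)) ∘ₗ
        (ContinuousLinearMap.coeLM ℝ : (E →L[ℝ] E) →ₗ[ℝ] (E →ₗ[ℝ] E))
    have : (fun A : E →L[ℝ] E => LinearMap.toMatrix b b (LinearMap.id + A.toLinearMap) i j) =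
        fun A => b.repr (b j) i + LinearMap.toContinuousLinearMap L A := by
      funext A
      simp [L, LinearMap.toMatrix_apply]
    rw [this]
    exact (ContinuousLinearMap.differentiable _).const_add _
  have hdiff : Differentiable ℝ
      (fun A : E →L[ℝ] E => LinearMap.det (LinearMap.id + A.toLinearMap)) := by
    have : (fun A : E →L[ℝ] E => LinearMap.det (LinearMap.id + A.toLinearMap)) = fun A =>
        ∑ σ : Equiv.Perm (Fin (Module.finrank ℝ E)), ((Equiv.Perm.sign σ : ℤ) : ℝ) *
          ∏ i, LinearMap.toMatrix b b (LinearMap.id + A.toLinearMap) (σ i) i := by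
      funext A
      rw [← LinearMap.det_toMatrix b, Matrix.det_apply']
    rw [this]
    refine Differentiable.fun_sum fun σ _ => Differentiable.const_mul ?_ _
    exact fun A => (HasFDerivAt.finsetProd fun i _ =>
      (hentry (σ i) i A).hasFDerivAt).differentiableAt
  have h0 := (hdiff 0).hasFDerivAt
  convert h0 using 1
  ext A
  have hline : HasDerivAt (fun r : ℝ => r • A) A 0 := by
    simpa using (hasDerivAt_id (0 : ℝ)).smul_const A
  have h0' : HasFDerivAt (fun A : E →L[ℝ] E => LinearMap.det (LinearMap.id + A.toLinearMap))
      (fderiv ℝ (fun A : E →L[ℝ] E => LinearMap.det (LinearMap.id + A.toLinearMap)) 0)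
      ((0 : ℝ) • A) := by simpa using h0
  have h1 := h0'.comp_hasDerivAt (0 : ℝ) hline
  exact (hasDerivAt_det_one_add_smul A.toLinearMap).unique h1

/-- First order expansion of `log det (id - A)` at `A = 0`. -/
theorem exists_abs_log_det_id_sub_add_trace_le {E : Type*} [NormedAddCommGroup E]
    [NormedSpace ℝ E] [FiniteDimensional ℝ E] {ε : ℝ} (hε : 0 < ε) :
    ∃ δ > 0, ∀ A : E →L[ℝ] E, ‖A‖ < δ →
      |Real.log (LinearMap.det (LinearMap.id - A.toLinearMap)) + traceCLM E A| ≤ ε * ‖A‖ := by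
  have h := (hasFDerivAt_det_id_add (E := E)).log (by simp)
  have h' := h.isLittleO.def hε
  obtain ⟨δ, hδ, H⟩ := Metric.eventually_nhds_iff.1 h'
  refine ⟨δ, hδ, fun A hA => ?_⟩
  have := H (y := -A) (by simpa using hA)
  simpa [sub_eq_add_neg] using this

/-- If `f` is jointly continuous and its second derivative in the last variable is uniformly
bounded, then its first derivative in the last variable is jointly continuous. -/
theorem continuous_fderiv_of_norm_fderiv_fderiv_le {α E F : Type*} [TopologicalSpace α]
    [NormedAddCommGroup E] [NormedSpace ℝ E] [FiniteDimensional ℝ E]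
    [NormedAddCommGroup F] [NormedSpace ℝ F] {f : α → E → F}
    (hfc : Continuous fun p : α × E => f p.1 p.2) (hfs : ∀ t, ContDiff ℝ 2 (f t)) {C : ℝ}
    (hC : ∀ t x, ‖fderiv ℝ (fderiv ℝ (f t)) x‖ ≤ C) :
    Continuous fun p : α × E => fderiv ℝ (f p.1) p.2 := by
  refine continuous_clm_apply.2 fun v => ?_
  refine continuous_of_uniform_approx_of_continuous fun u hu => ?_
  obtain ⟨ε, hε, hεu⟩ := Metric.mem_uniformity_dist.1 hu
  obtain ⟨r, hr, hrε⟩ : ∃ r > 0, C * ‖v‖ * ‖v‖ * r < ε := by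
    refine ⟨ε / (|C * ‖v‖ * ‖v‖| + 1), by positivity, ?_⟩
    rw [← mul_div_assoc, div_lt_iff₀ (by positivity)]
    nlinarith [le_abs_self (C * ‖v‖ * ‖v‖)]
  refine ⟨fun p => r⁻¹ • (f p.1 (p.2 + r • v) - f p.1 p.2), ?_, ?_⟩
  · have : Continuous fun p : α × E => f p.1 (p.2 + r • v) :=
      hfc.comp (continuous_fst.prodMk (continuous_snd.add continuous_const))
    exact (this.sub hfc).const_smul _
  rintro ⟨t, x⟩
  apply hεu
  have hd : ∀ y, DifferentiableAt ℝ (f t) y := (hfs t).differentiable (by norm_num)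
  have hd2 : Differentiable ℝ (fderiv ℝ (f t)) :=
    ((hfs t).fderiv_right (m := 1) (by norm_num)).differentiable (by norm_num)
  have hb : ∀ y ∈ Metric.closedBall x ‖r • v‖,
      ‖fderiv ℝ (f t) y - fderiv ℝ (f t) x‖ ≤ C * ‖r • v‖ := by
    intro y hy
    refine (convex_univ.norm_image_sub_le_of_norm_fderiv_le (fun z _ => hd2 z)
      (fun z _ => hC t z) (mem_univ x) (mem_univ y)).trans ?_
    gcongr
    · exact (norm_nonneg (fderiv ℝ (fderiv ℝ (f t)) x)).trans (hC t x)
    · simpa [dist_eq_norm] using hy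
  have key := (convex_closedBall x ‖r • v‖).norm_image_sub_le_of_norm_fderiv_le'
    (fun y _ => hd y) hb (Metric.mem_closedBall_self (norm_nonneg _))
    (show x + r • v ∈ _ by simp)
  have heq : fderiv ℝ (f t) x v - r⁻¹ • (f t (x + r • v) - f t x) =
      -(r⁻¹ • (f t (x + r • v) - f t x - fderiv ℝ (f t) x (x + r • v - x))) := by
    simp only [add_sub_cancel_left, map_smul, smul_sub, inv_smul_smul₀ hr.ne']
    abel
  simp only [dist_eq_norm]
  rw [heq, norm_neg, norm_smul, norm_inv, Real.norm_of_nonneg hr.le]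
  calc r⁻¹ * _ ≤ r⁻¹ * (C * ‖r • v‖ * ‖x + r • v - x‖) := by gcongr
    _ = C * ‖v‖ * ‖v‖ * r := by
      rw [add_sub_cancel_left, norm_smul, Real.norm_of_nonneg hr.le]
      field_simp
    _ < ε := hrε

theorem IsCM.sub {n : ℕ} {T : ℝ} (hT : 0 ≤ T) {φ φ' ψ ψ' : ℝ → EuclideanSpace ℝ (Fin n)}
    (hφ : IsCM T φ φ') (hψ : IsCM T ψ ψ') :
    IsCM T (fun s => φ s - ψ s) (fun s => φ' s - ψ' s) := by
  refine ⟨hφ.1.sub hψ.1, fun t ht => ?_, ?_⟩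
  · have hsub : uIcc 0 t ⊆ uIcc 0 T := by
      rw [uIcc_of_le ht.1, uIcc_of_le hT]
      exact Icc_subset_Icc_right ht.2
    rw [intervalIntegral.integral_sub (hφ.1.mono_set hsub) (hψ.1.mono_set hsub),
      sub_add_sub_comm, ← hφ.2.1 t ht, ← hψ.2.1 t ht]
  · refine ((hφ.2.2.const_mul 2).add (hψ.2.2.const_mul 2)).mono_fun
      ((hφ.1.sub hψ.1).def'.aestronglyMeasurable.norm.pow 2) (ae_of_all _ fun s => ?_)
    have h := parallelogram_law_with_norm ℝ (φ' s) (ψ' s)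
    simp only [norm_pow, norm_norm]
    refine le_trans ?_ (le_abs_self _)
    nlinarith [sq_nonneg ‖φ' s + ψ' s‖]

theorem IsCM.continuousOn {n : ℕ} {T : ℝ} (hT : 0 ≤ T) {φ φ' : ℝ → EuclideanSpace ℝ (Fin n)}
    (hφ : IsCM T φ φ') : ContinuousOn φ (Icc 0 T) := by
  have h := intervalIntegral.continuousOn_primitive_interval (μ := volume) (f := φ') (a := 0)
    (b := T) ((intervalIntegrable_iff' (by simp)).1 hφ.1)
  rw [uIcc_of_le hT] at h
  exact (continuousOn_const.add h).congr hφ.2.1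

/-- The Cameron–Martin norm controls the uniform norm. -/
theorem IsCM.norm_le_of_sqrt_cmNormSq_le {n : ℕ} {T : ℝ} (hT : 0 ≤ T)
    {φ φ' : ℝ → EuclideanSpace ℝ (Fin n)} (hφ : IsCM T φ φ') {ε : ℝ} (hε : 0 < ε)
    (h : Real.sqrt (cmNormSq T φ φ') ≤ ε) {t : ℝ} (ht : t ∈ Icc 0 T) :
    ‖φ t‖ ≤ ε * (T + 2) := by
  have hsq : cmNormSq T φ φ' ≤ ε ^ 2 := (Real.sqrt_le_left hε.le).1 h
  have hint : 0 ≤ ∫ s in (0 : ℝ)..T, ‖φ' s‖ ^ 2 :=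
    intervalIntegral.integral_nonneg hT fun s _ => by positivity
  unfold cmNormSq at hsq
  have h0 : ‖φ 0‖ ≤ ε := abs_le_of_sq_le_sq' (by linarith) hε.le |>.2
  have hI : ‖∫ s in (0 : ℝ)..t, φ' s‖ ≤ ε * T + ε := by
    calc ‖∫ s in (0 : ℝ)..t, φ' s‖ ≤ ∫ s in (0 : ℝ)..t, ‖φ' s‖ :=
          intervalIntegral.norm_integral_le_integral_norm ht.1
      _ ≤ ∫ s in (0 : ℝ)..T, ‖φ' s‖ :=
          intervalIntegral.integral_mono_interval le_rfl ht.1 ht.2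
            (ae_of_all _ fun s => norm_nonneg _) hφ.1.norm
      _ ≤ ∫ s in (0 : ℝ)..T, (ε + ε⁻¹ * ‖φ' s‖ ^ 2) := by
          refine intervalIntegral.integral_mono_on hT hφ.1.norm
            (intervalIntegrable_const.add (hφ.2.2.const_mul _)) fun s _ => ?_
          rw [← mul_le_mul_iff_right₀ hε, mul_add, mul_inv_cancel_left₀ hε.ne']
          nlinarith [sq_nonneg (ε - ‖φ' s‖), norm_nonneg (φ' s)]
      _ = ε * T + ε⁻¹ * ∫ s in (0 : ℝ)..T, ‖φ' s‖ ^ 2 := by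
          rw [intervalIntegral.integral_add intervalIntegrable_const (hφ.2.2.const_mul _),
            intervalIntegral.integral_const, intervalIntegral.integral_const_mul]
          simp [mul_comm]
      _ ≤ ε * T + ε⁻¹ * ε ^ 2 := by
          gcongr
          nlinarith [sq_nonneg ‖φ 0‖]
      _ = ε * T + ε := by field_simp
  rw [hφ.2.1 t ht]
  linarith [norm_add_le (φ 0) (∫ s in (0 : ℝ)..t, φ' s)]

namespace NestedPartitions

variable {T : ℝ} {tt : ℕ → ℕ → ℝ} {N : ℕ → ℕ}

theorem monotoneOn (hp : NestedPartitions T tt N) (i : ℕ) : MonotoneOn (tt i) (Iic (N i)) := by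
  intro a _ b hb hab
  induction b, hab using Nat.le_induction with
  | base => exact le_rfl
  | succ m _ ih =>
    exact (ih (Nat.le_of_succ_le hb)).trans (hp.mono i m hb).le

theorem mem_Icc (hp : NestedPartitions T tt N) {i k : ℕ} (hk : k ≤ N i) : tt i k ∈ Icc 0 T := by
  refine ⟨?_, ?_⟩
  · rw [← hp.zero i]
    exact hp.monotoneOn i (Nat.zero_le _) hk (Nat.zero_le _)
  · rw [← hp.last i]
    exact hp.monotoneOn i hk self_mem_Iic hk

theorem sub_le_mesh {i k : ℕ} (hk : k < N i) : tt i (k + 1) - tt i k ≤ mesh tt N i :=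
  le_ciSup (f := fun k : Fin (N i) => tt i (k + 1) - tt i k) (finite_range _).bddAbove ⟨k, hk⟩

/-- Sums over the cells tend to zero when the terms are uniformly negligible with respect to the
cell lengths. -/
theorem tendsto_sum_zero (hp : NestedPartitions T tt N) {a : ℕ → ℕ → ℝ}
    (ha : ∀ ε > 0, ∀ᶠ i in atTop, ∀ k < N i, |a i k| ≤ ε * (tt i (k + 1) - tt i k)) :
    Tendsto (fun i => ∑ k ∈ Finset.range (N i), a i k) atTop (nhds 0) := by
  have hT : 0 ≤ T := by simpa [hp.zero] using (hp.mem_Icc (Nat.zero_le (N 0))).2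
  refine Metric.tendsto_nhds.2 fun ε hε => ?_
  filter_upwards [ha (ε / (T + 1)) (by positivity)] with i hi
  rw [Real.dist_0_eq_abs]
  calc |∑ k ∈ Finset.range (N i), a i k|
      ≤ ∑ k ∈ Finset.range (N i), |a i k| := Finset.abs_sum_le_sum_abs _ _
    _ ≤ ∑ k ∈ Finset.range (N i), ε / (T + 1) * (tt i (k + 1) - tt i k) :=
        Finset.sum_le_sum fun k hk => hi k (Finset.mem_range.1 hk)
    _ = ε / (T + 1) * T := by
        rw [← Finset.mul_sum, Finset.sum_range_sub, hp.last, hp.zero, sub_zero]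
    _ < ε := by
        rw [div_mul_eq_mul_div, div_lt_iff₀ (by positivity)]
        nlinarith

/-- On fine partitions, the integral of a continuous function over each cell is close to the right
endpoint rule. -/
theorem eventually_abs_mul_sub_integral_le (hp : NestedPartitions T tt N) {h : ℝ → ℝ}
    (hh : ContinuousOn h (Icc 0 T)) {ε : ℝ} (hε : 0 < ε) :
    ∀ᶠ i in atTop, ∀ k < N i,
      |(tt i (k + 1) - tt i k) * h (tt i (k + 1)) - ∫ s in tt i k..tt i (k + 1), h s| ≤
        ε * (tt i (k + 1) - tt i k) := by
  have huc := isCompact_Icc.uniformContinuousOn_of_continuous hh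
  obtain ⟨δ, hδ, H⟩ := Metric.uniformContinuousOn_iff.1 huc ε hε
  filter_upwards [hp.meshZero.eventually_lt_const hδ] with i hi k hk
  have hlt := hp.mono i k hk
  have hl := hp.mem_Icc (i := i) hk.le
  have hr := hp.mem_Icc (i := i) (Nat.succ_le_of_lt hk)
  have hsub : Icc (tt i k) (tt i (k + 1)) ⊆ Icc 0 T := Icc_subset_Icc hl.1 hr.2
  have hint : IntervalIntegrable h volume (tt i k) (tt i (k + 1)) :=
    ContinuousOn.intervalIntegrable_of_Icc hlt.le (hh.mono hsub)
  rw [← smul_eq_mul, ← intervalIntegral.integral_const,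
    ← intervalIntegral.integral_sub intervalIntegrable_const hint]
  have := intervalIntegral.norm_integral_le_of_norm_le_const (a := tt i k) (b := tt i (k + 1))
    (C := ε) (f := fun s => h (tt i (k + 1)) - h s) fun s hs => ?_
  · rwa [abs_of_pos (sub_pos.2 hlt)] at this
  · rw [uIoc_of_le hlt.le] at hs
    refine (H _ hr _ (hsub (Ioc_subset_Icc_self hs)) ?_).le
    rw [Real.dist_eq, abs_of_nonneg (by linarith [hs.2])]
    linarith [hs.1, sub_le_mesh (tt := tt) hk]

end NestedPartitions

/-- Convergence of the log-determinant correction sums: if `φᵢ ∈ Hᵢ` converge to `φ` in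
the Cameron–Martin norm, then
`Σₖ ln det(I - ½δₖ ∇ₓf(tₖ₊₁, φᵢ(tₖ₊₁))) → -½ ∫₀ᵀ divₓ f(t, φ(t)) dt`. -/
theorem logdet_sums_converge_to_divergence_integral {n : ℕ} (T : ℝ) (hT : 0 < T)
    (tt : ℕ → ℕ → ℝ) (N : ℕ → ℕ) (hpart : NestedPartitions T tt N)
    (c₃ : ℝ) (hc₃ : ∀ i, (N i : ℝ) * mesh tt N i ≤ c₃)
    (f : ℝ → EuclideanSpace ℝ (Fin n) → EuclideanSpace ℝ (Fin n))
    (hfc : Continuous fun p : ℝ × EuclideanSpace ℝ (Fin n) => f p.1 p.2)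
    (hfs : ∀ t, ContDiff ℝ 2 (f t))
    (C : ℝ)
    (hfb : ∀ t x, ‖f t x‖ ≤ C ∧ ‖fderiv ℝ (f t) x‖ ≤ C ∧
      ‖fderiv ℝ (fderiv ℝ (f t)) x‖ ≤ C)
    (φ φ' : ℝ → EuclideanSpace ℝ (Fin n)) (hφ : IsCM T φ φ')
    (Φ Φ' : ℕ → ℝ → EuclideanSpace ℝ (Fin n))
    (hpl : ∀ i, IsPL (tt i) (N i) (Φ i))
    (hpld : ∀ i, IsPLDeriv (tt i) (N i) (Φ i) (Φ' i))
    (hcm : ∀ i, IsCM T (Φ i) (Φ' i))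
    (hconv : Tendsto (fun i => Real.sqrt (cmNormSq T (fun s => Φ i s - φ s)
      (fun s => Φ' i s - φ' s))) atTop (nhds 0)) :
    Tendsto
      (fun i =>
        ∑ k ∈ Finset.range (N i),
          Real.log (LinearMap.det
            ((LinearMap.id : EuclideanSpace ℝ (Fin n) →ₗ[ℝ] EuclideanSpace ℝ (Fin n)) -
              ((tt i (k + 1) - tt i k) / 2) •
                (fderiv ℝ (f (tt i (k + 1))) (Φ i (tt i (k + 1)))).toLinearMap)))
      atTop
      (nhds (-(1 / 2) *
        ∫ t in (0 : ℝ)..T,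
          LinearMap.trace ℝ (EuclideanSpace ℝ (Fin n))
            (fderiv ℝ (f t) (φ t)).toLinearMap)) := by
  have hfd := continuous_fderiv_of_norm_fderiv_fderiv_le hfc hfs fun t x => (hfb t x).2.2
  have hC : 0 ≤ C := (norm_nonneg _).trans (hfb 0 0).1
  set L := traceCLM (EuclideanSpace ℝ (Fin n)) with hL
  let h : ℝ → ℝ := fun t => L (fderiv ℝ (f t) (φ t))
  have hh : ContinuousOn h (Icc 0 T) :=
    L.continuous.comp_continuousOn
      (hfd.comp_continuousOn (continuousOn_id.prodMk (hφ.continuousOn hT.le)))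
  have hlip : ∀ t x y, |L (fderiv ℝ (f t) x) - L (fderiv ℝ (f t) y)| ≤ ‖L‖ * (C * ‖x - y‖) := by
    intro t x y
    rw [← map_sub, ← Real.norm_eq_abs]
    refine (L.le_opNorm _).trans ?_
    gcongr
    have hd2 : Differentiable ℝ (fderiv ℝ (f t)) :=
      ((hfs t).fderiv_right (m := 1) (by norm_num)).differentiable (by norm_num)
    exact convex_univ.norm_image_sub_le_of_norm_fderiv_le (fun z _ => hd2 z)
      (fun z _ => (hfb t z).2.2) (mem_univ y) (mem_univ x)
  have hunif : ∀ ε > 0, ∀ᶠ i in atTop, ∀ t ∈ Icc (0 : ℝ) T, ‖Φ i t - φ t‖ ≤ ε * (T + 2) :=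
    fun ε hε => by
      filter_upwards [hconv.eventually_lt_const hε] with i hi t ht
      exact ((hcm i).sub hT.le hφ).norm_le_of_sqrt_cmNormSq_le hT.le hε hi.le ht
  have key := hpart.tendsto_sum_zero (a := fun i k =>
    Real.log (LinearMap.det
      ((LinearMap.id : EuclideanSpace ℝ (Fin n) →ₗ[ℝ] EuclideanSpace ℝ (Fin n)) -
        ((tt i (k + 1) - tt i k) / 2) •
          (fderiv ℝ (f (tt i (k + 1))) (Φ i (tt i (k + 1)))).toLinearMap)) +
      1 / 2 * ∫ s in tt i k..tt i (k + 1), h s) ?_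
  · have hsum : ∀ i, ∑ k ∈ Finset.range (N i), 1 / 2 * ∫ s in tt i k..tt i (k + 1), h s =
        1 / 2 * ∫ s in (0 : ℝ)..T, h s := fun i => by
      rw [← Finset.mul_sum, intervalIntegral.sum_integral_adjacent_intervals, hpart.zero,
        hpart.last]
      intro k hk
      exact ContinuousOn.intervalIntegrable_of_Icc (hpart.mono i k hk).le
        (hh.mono (Icc_subset_Icc (hpart.mem_Icc hk.le).1 (hpart.mem_Icc (Nat.succ_le_of_lt hk)).2))
    simp only [Finset.sum_add_distrib, hsum] at key
    simpa [h, hL] using key.sub_const (1 / 2 * ∫ s in (0 : ℝ)..T, h s)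
  intro ε hε
  obtain ⟨δ, hδ, hlog⟩ := exists_abs_log_det_id_sub_add_trace_le
    (E := EuclideanSpace ℝ (Fin n)) (ε := ε / 2 / (C + 1)) (by positivity)
  have hη : 0 < ε / ((‖L‖ * C + 1) * (T + 2)) := by positivity
  filter_upwards [hpart.meshZero.eventually_lt_const (show 0 < δ / (C + 1) by positivity),
    hunif _ hη, hpart.eventually_abs_mul_sub_integral_le hh (half_pos hε)] with i hmesh hΦ hR k hk
  have hd : 0 < tt i (k + 1) - tt i k := sub_pos.2 (hpart.mono i k hk)
  have hdm : tt i (k + 1) - tt i k < δ / (C + 1) :=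
    (NestedPartitions.sub_le_mesh (tt := tt) hk).trans_lt hmesh
  have hr := hpart.mem_Icc (i := i) (Nat.succ_le_of_lt hk)
  have h3 := hR k hk
  have h2 := (hlip (tt i (k + 1)) (Φ i (tt i (k + 1))) (φ (tt i (k + 1)))).trans
    (mul_le_mul_of_nonneg_left (mul_le_mul_of_nonneg_left (hΦ _ hr) hC) (norm_nonneg L))
  have h2' : ‖L‖ * (C * (ε / ((‖L‖ * C + 1) * (T + 2)) * (T + 2))) ≤ ε := by
    have : ‖L‖ * (C * (ε / ((‖L‖ * C + 1) * (T + 2)) * (T + 2))) =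
        ε * (‖L‖ * C) / (‖L‖ * C + 1) := by
      field_simp
    rw [this, div_le_iff₀ (by positivity)]
    nlinarith
  set d := tt i (k + 1) - tt i k
  set B := fderiv ℝ (f (tt i (k + 1))) (Φ i (tt i (k + 1)))
  have hBC : ‖B‖ ≤ C := (hfb _ _).2.1
  have hnorm : ‖(d / 2) • B‖ ≤ d / 2 * C := by
    rw [norm_smul, Real.norm_of_nonneg (by positivity)]
    gcongr
  have h1 := hlog ((d / 2) • B) <| hnorm.trans_lt <| by
    rw [lt_div_iff₀ (by positivity)] at hdm
    nlinarith
  have h1' : ε / 2 / (C + 1) * ‖(d / 2) • B‖ ≤ ε * d / 4 := by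
    calc ε / 2 / (C + 1) * ‖(d / 2) • B‖ ≤ ε / 2 / (C + 1) * (d / 2 * C) := by gcongr
      _ = ε * d / 4 * (C / (C + 1)) := by ring
      _ ≤ ε * d / 4 * 1 := by
        gcongr
        rw [div_le_one (by positivity)]
        linarith
      _ = ε * d / 4 := mul_one _
  replace h1 := h1.trans h1'
  replace h2 := h2.trans h2'
  rw [← hL, map_smul, smul_eq_mul, ContinuousLinearMap.toLinearMap_smul] at h1
  change |d * L (fderiv ℝ (f (tt i (k + 1))) (φ (tt i (k + 1)))) - _| ≤ _ at h3
  rw [abs_le] at h1 h2 h3 ⊢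
  have h2a := mul_le_mul_of_nonneg_left h2.1 hd.le
  have h2b := mul_le_mul_of_nonneg_left h2.2 hd.le
  constructor <;> linarith
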